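/- arXiv:1208.3094 — 4 statements merged into one kernel-verified Lean document; each statement's English description precedes it below -/
import Mathlib

section
/- Let A ≠ 0 be a non-negative operator in the Krein space K, let K be indefinite, and assume ker A = {0}. Then both σℝ(A) ∩ (-∞,0) and σℝ(A) ∩ (0,∞) are nonempty (so μ₋ > -∞ and μ₊ < ∞), and W(A) ∪ {μ₋, μ₊} = (-∞, μ₋] ∪ [μ₊, ∞). -/
open Set Filter Topology

variable {K : Type*} [NormedAddCommGroup K] [InnerProductSpace ℂ K] [CompleteSpace K]

/-- The real part of the Krein space inner product `[x, y] = ⟪J x, y⟫`. -/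
noncomputable def kreinRe (J : K →L[ℂ] K) (x y : K) : ℝ :=
  (@inner ℂ K _ (J x) y).re

/-- `J` is a fundamental symmetry: selfadjoint and an involution. -/
def IsFundamentalSymmetry (J : K →L[ℂ] K) : Prop :=
  IsSelfAdjoint J ∧ J ∘L J = 1

/-- `A` is a non-negative operator in the Krein space `(K, [·,·])` induced by `J`:
`J ∘ A` is selfadjoint on the Hilbert space `K` and `[A x, x] ≥ 0` for all `x`. -/
def IsKreinNonneg (J A : K →L[ℂ] K) : Prop :=
  IsSelfAdjoint (J ∘L A) ∧ ∀ x : K, 0 ≤ kreinRe J (A x) x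

/-- The Krein space numerical range `W(A)`. -/
noncomputable def kreinW (J A : K →L[ℂ] K) : Set ℝ :=
  {r : ℝ | ∃ x : K, kreinRe J x x ≠ 0 ∧ r = kreinRe J (A x) x / kreinRe J x x}

/-- The Krein space co-numerical range `W_co(A)`. -/
noncomputable def kreinWco (J A : K →L[ℂ] K) : Set ℝ :=
  {r : ℝ | ∃ x : K, kreinRe J (A x) x ≠ 0 ∧
    r = kreinRe J (A x) (A x) / kreinRe J (A x) x}

/-- The real spectrum `σℝ(A)` of `A`. -/
def sigmaR (A : K →L[ℂ] K) : Set ℝ := {t : ℝ | (t : ℂ) ∈ spectrum ℂ A}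

/-- The Krein space `(K, [·,·])` is indefinite. -/
def KreinIndefinite (J : K →L[ℂ] K) : Prop :=
  (∃ x : K, 0 < kreinRe J x x) ∧ ∃ y : K, kreinRe J y y < 0

namespace KreinAux

open ContinuousLinearMap

lemma exists_sqrt {B : K →L[ℂ] K} (hB : B.IsPositive) :
    ∃ S : K →L[ℂ] K, IsSelfAdjoint S ∧ S * S = B := by
  have h0 : 0 ≤ B := (nonneg_iff_isPositive B).2 hB
  exact ⟨CFC.sqrt B, IsSelfAdjoint.of_nonneg (CFC.sqrt_nonneg B), CFC.sqrt_mul_sqrt_self B h0⟩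

lemma mulA (S T : K →L[ℂ] K) (x : K) : (S * T) x = S (T x) := rfl

lemma sa_inner {S : K →L[ℂ] K} (hS : IsSelfAdjoint S) (x y : K) :
    @inner ℂ K _ (S x) y = @inner ℂ K _ x (S y) := hS.isSymmetric x y

lemma pos_of {C : K →L[ℂ] K} (hC : IsSelfAdjoint C)
    (h : ∀ x, 0 ≤ (@inner ℂ K _ (C x) x).re) : C.IsPositive :=
  isPositive_def'.mpr ⟨hC, h⟩

lemma pos_bound {C : K →L[ℂ] K} (hC : C.IsPositive) :
    ∃ M : ℝ, 0 ≤ M ∧ ∀ x, ‖C x‖ ^ 2 ≤ M * (@inner ℂ K _ (C x) x).re := by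
  obtain ⟨S, hS, rfl⟩ := exists_sqrt hC
  refine ⟨‖S‖ ^ 2, by positivity, fun x => ?_⟩
  have h1 : (@inner ℂ K _ ((S * S) x) x).re = ‖S x‖ ^ 2 := by
    rw [mulA, sa_inner hS]
    exact inner_self_eq_norm_sq (𝕜 := ℂ) (S x)
  rw [h1, ← mul_pow, mulA]
  gcongr
  exact S.le_opNorm _

lemma gap {J A : K →L[ℂ] K} (hJ : IsFundamentalSymmetry J)
    (hA : IsKreinNonneg J A) (hker : ∀ x : K, A x = 0 → x = 0) {ε : ℝ}
    (hε : 0 ≤ ε) (h : ∀ t, 0 < t → t < ε → t ∉ sigmaR A) (x : K) :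
    ε * kreinRe J x x ≤ kreinRe J (A x) x := by
  obtain ⟨hJs, hJJ⟩ := hJ
  have hJJ' : ∀ x, J (J x) = x := fun x => by
    have := congrArg (fun f : K →L[ℂ] K => f x) hJJ
    simpa using this
  obtain ⟨S, hS, hSS⟩ := exists_sqrt (pos_of hA.1 hA.2)
  have hSS' : ∀ x, S (S x) = J (A x) := fun x => by
    have := congrArg (fun f : K →L[ℂ] K => f x) hSS
    simpa using this
  have hAeq : A = (J * S) * S := by
    ext x
    simp [hSS', hJJ']
  set T : K →L[ℂ] K := S * (J * S) with hT
  have hTs : IsSelfAdjoint T := by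
    rw [IsSelfAdjoint, hT, star_mul, star_mul, hS.star_eq, hJs.star_eq, mul_assoc]
  have hpos : 0 ≤ T ^ 2 - ε • T := by
    have e : cfc (fun t : ℝ => t ^ 2 - ε * t) T = T ^ 2 - ε • T := by
      rw [cfc_sub (fun t : ℝ => t ^ 2) (fun t : ℝ => ε * t) T, cfc_pow_id T 2, cfc_const_mul_id ε T]
    rw [← e]
    refine cfc_nonneg fun t ht => ?_
    by_cases h0 : t ≤ 0
    · nlinarith [mul_nonneg hε (neg_nonneg.2 h0)]
    · push Not at h0
      by_cases h1 : t < ε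
      · exfalso
        refine h t h0 h1 ?_
        have ht' : (t : ℂ) ∈ spectrum ℂ T := spectrum.algebraMap_mem ℂ ht
        have : (t : ℂ) ∈ spectrum ℂ T \ {0} := ⟨ht', by simpa using h0.ne'⟩
        rw [hT, spectrum.nonzero_mul_comm, ← hAeq] at this
        exact this.1
      · push Not at h1
        nlinarith
  have hSinj : ∀ x, S x = 0 → x = 0 := fun x hx => by
    apply hker
    rw [hAeq]; simp [hx]
  have hd : DenseRange S := by
    have h1 : (LinearMap.range S.toLinearMap)ᗮ = ⊥ := by
      rw [Submodule.eq_bot_iff]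
      intro y hy
      apply hSinj
      rw [← inner_self_eq_zero (𝕜 := ℂ), sa_inner hS]
      have := (Submodule.mem_orthogonal _ _).1 hy (S (S y)) ⟨S y, rfl⟩
      rw [← inner_conj_symm, this]; simp
    have h2 := Submodule.topologicalClosure_eq_top_iff.2 h1
    exact Submodule.dense_iff_topologicalClosure_eq_top.2 h2
  have hd2 : DenseRange (J ∘ S) :=
    (Function.Surjective.denseRange fun x => ⟨J x, hJJ' x⟩).comp hd J.continuous
  refine hd2.induction_on (p := fun x => ε * kreinRe J x x ≤ kreinRe J (A x) x) x ?_ ?_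
  · unfold kreinRe
    refine isClosed_le ?_ ?_ <;> fun_prop
  · intro y
    have := ((nonneg_iff_isPositive _).1 hpos).re_inner_nonneg_left y
    have e1 : @inner ℂ K _ ((T ^ 2) y) y = @inner ℂ K _ (J (A (J (S y)))) (J (S y)) := by
      rw [← hSS', pow_two, hT]
      simp only [mulA]
      rw [sa_inner hS, sa_inner hJs]
    have e2 : @inner ℂ K _ (T y) y = @inner ℂ K _ (J (J (S y))) (J (S y)) := by
      rw [hJJ', hT]
      simp only [mulA]
      rw [sa_inner hS, sa_inner hJs]
    have e3 : (ε • T) y = (ε : ℂ) • T y := by simp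
    rw [sub_apply, inner_sub_left, e3, inner_smul_left, e1, e2] at this
    simp only [kreinRe, Function.comp_apply]
    simpa using this

lemma gap_conv {J A : K →L[ℂ] K} (hJ : IsFundamentalSymmetry J)
    (hA : IsKreinNonneg J A) {ε : ℝ}
    (h : ∀ x, ε * kreinRe J x x ≤ kreinRe J (A x) x) (t : ℝ) (ht : 0 < t) (htε : t < ε) :
    t ∉ sigmaR A := by
  obtain ⟨hJs, hJJ⟩ := hJ
  have hJJ' : ∀ x, J (J x) = x := fun x => by
    have := congrArg (fun f : K →L[ℂ] K => f x) hJJ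
    simpa using this
  have hJn : ∀ x, ‖J x‖ ^ 2 = ‖x‖ ^ 2 := fun x => by
    rw [← inner_self_eq_norm_sq (𝕜 := ℂ), sa_inner hJs, hJJ', inner_self_eq_norm_sq]
  have hε : 0 < ε := ht.trans htε
  have hB := pos_of hA.1 hA.2
  have qC : ∀ (s : ℝ) x, (@inner ℂ K _ ((J ∘L A - s • J) x) x).re
      = kreinRe J (A x) x - s * kreinRe J x x := fun s x => by
    have e3 : (s • J) x = (s : ℂ) • J x := by simp
    rw [sub_apply, inner_sub_left, e3, inner_smul_left]
    simp [kreinRe]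
  have hC : (J ∘L A - ε • J).IsPositive := by
    refine pos_of (hA.1.sub ((IsSelfAdjoint.all ε).smul hJs)) fun x => ?_
    rw [qC]; linarith [h x]
  obtain ⟨M, hM, hMB⟩ := pos_bound hB
  obtain ⟨N, hN, hNC⟩ := pos_bound hC
  -- coercivity
  have hco : ∃ c : ℝ, 0 < c ∧ ∀ x, ‖x‖ ^ 2 * c ≤ kreinRe J (A x) x - t * kreinRe J x x := by
    set δ := min (1 - t / ε) (t / ε) with hδ
    have h1 : t / ε < 1 := (div_lt_one hε).2 htε
    have h2 : 0 < t / ε := by positivity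
    have hδ0 : 0 < δ := lt_min (by linarith) h2
    refine ⟨ε ^ 2 * δ / (2 * (M + N + 1)), by positivity, fun x => ?_⟩
    set b := kreinRe J (A x) x with hb
    set j := kreinRe J x x with hj
    have hb0 : 0 ≤ b := hA.2 x
    have hc0 : 0 ≤ b - ε * j := by linarith [h x]
    have e1 : ‖(J ∘L A) x‖ ^ 2 ≤ M * b := hMB x
    have e2 : ‖(J ∘L A - ε • J) x‖ ^ 2 ≤ N * (b - ε * j) := by
      have := hNC x
      rwa [qC] at this
    have e3 : ε ^ 2 * ‖x‖ ^ 2 ≤ 2 * (M * b + N * (b - ε * j)) := by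
      have e4 : ε • J x = (J ∘L A) x - (J ∘L A - ε • J) x := by simp
      have e5 : ‖ε • J x‖ ≤ ‖(J ∘L A) x‖ + ‖(J ∘L A - ε • J) x‖ := by
        rw [e4]; exact norm_sub_le _ _
      have e6 : ‖ε • J x‖ ^ 2 = ε ^ 2 * ‖x‖ ^ 2 := by
        rw [norm_smul, mul_pow, hJn]; simp
      rw [← e6]
      have := pow_le_pow_left₀ (norm_nonneg _) e5 2
      nlinarith [sq_nonneg (‖(J ∘L A) x‖ - ‖(J ∘L A - ε • J) x‖)]
    have e7 : b - t * j = (1 - t / ε) * b + (t / ε) * (b - ε * j) := by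
      field_simp; ring
    have e8 : δ * (b + (b - ε * j)) ≤ b - t * j := by
      rw [e7, mul_add]
      gcongr
      · exact min_le_left _ _
      · exact min_le_right _ _
    have e9 : ε ^ 2 * ‖x‖ ^ 2 ≤ 2 * (M + N + 1) * (b + (b - ε * j)) := by
      nlinarith [mul_nonneg hM hc0, mul_nonneg hN hb0]
    rw [mul_div_assoc', div_le_iff₀ (by positivity)]
    calc ‖x‖ ^ 2 * (ε ^ 2 * δ) = δ * (ε ^ 2 * ‖x‖ ^ 2) := by ring
      _ ≤ δ * (2 * (M + N + 1) * (b + (b - ε * j))) := by gcongr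
      _ = (δ * (b + (b - ε * j))) * (2 * (M + N + 1)) := by ring
      _ ≤ _ := by gcongr
  obtain ⟨c, hc, hcx⟩ := hco
  have hU : IsUnit (J ∘L A - t • J) := by
    refine isUnit_of_forall_le_norm_inner_map _ (c := ⟨c, hc.le⟩) hc fun x => ?_
    refine (hcx x).trans ?_
    rw [← qC]
    exact Complex.re_le_norm _
  have hJU : IsUnit J := ⟨⟨J, J, hJJ, hJJ⟩, rfl⟩
  have hmul := (hJU.mul hU).neg
  have heq : -(J * (J ∘L A - t • J)) = algebraMap ℂ (K →L[ℂ] K) t - A := by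
    ext x
    simp [hJJ', Algebra.algebraMap_eq_smul_one]
  rw [heq] at hmul
  exact fun hmem => (spectrum.mem_iff.1 hmem) hmul

lemma pos_strict {J A : K →L[ℂ] K} (hJ : IsFundamentalSymmetry J)
    (hA : IsKreinNonneg J A) (hker : ∀ x : K, A x = 0 → x = 0) {x : K} (hx : x ≠ 0) :
    0 < kreinRe J (A x) x := by
  refine lt_of_le_of_ne (hA.2 x) fun h0 => hx ?_
  obtain ⟨M, hM, hMB⟩ := pos_bound (pos_of hA.1 hA.2)
  have h1 : ‖J (A x)‖ ^ 2 ≤ M * kreinRe J (A x) x := hMB x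
  rw [← h0, mul_zero] at h1
  have h2 : J (A x) = 0 := by
    rw [← norm_eq_zero]; exact pow_eq_zero_iff two_ne_zero |>.1 (le_antisymm h1 (by positivity))
  apply hker
  have := congrArg (fun f : K →L[ℂ] K => f (A x)) hJ.2
  simpa [h2] using this.symm

lemma mem_W {J A : K →L[ℂ] K} (hJ : IsFundamentalSymmetry J)
    (hA : IsKreinNonneg J A) (hker : ∀ x : K, A x = 0 → x = 0) (hind : KreinIndefinite J)
    {t : ℝ} (ht : 0 < t) {x : K} (hx : kreinRe J (A x) x < t * kreinRe J x x) :
    t ∈ kreinW J A := by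
  obtain ⟨y, hy⟩ := hind.2
  -- the path from x to y
  let z : ℝ → K := fun s => x + (s : ℂ) • (y - x)
  let f : ℝ → ℝ := fun s => kreinRe J (A (z s)) (z s) - t * kreinRe J (z s) (z s)
  have hf : Continuous f := by
    simp only [f, z, kreinRe]
    fun_prop
  have hz0 : z 0 = x := by simp [z]
  have hz1 : z 1 = y := by simp [z]
  have h0 : f 0 < 0 := by simp only [f, hz0]; linarith
  have h1 : 0 < f 1 := by
    simp only [f, hz1]
    nlinarith [hA.2 y]
  obtain ⟨s, hs, hfs⟩ := intermediate_value_Icc zero_le_one hf.continuousOn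
    (show (0 : ℝ) ∈ Icc (f 0) (f 1) from ⟨h0.le, h1.le⟩)
  have hzs : z s ≠ 0 := by
    intro hz
    -- y is a real multiple relation
    have e : (s : ℂ) • y = ((s - 1 : ℝ) : ℂ) • x := by
      have : x + (s : ℂ) • (y - x) = 0 := hz
      rw [smul_sub] at this
      push_cast
      rw [sub_smul, one_smul]
      rw [← sub_eq_zero, ← this]; abel
    have sc : ∀ (r : ℝ) (u : K), kreinRe J ((r : ℂ) • u) ((r : ℂ) • u) = r ^ 2 * kreinRe J u u := by
      intro r u
      simp only [kreinRe, map_smul, inner_smul_left, inner_smul_right, Complex.conj_ofReal,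
        Complex.re_ofReal_mul]
      ring
    have e2 := sc s y
    rw [e, sc] at e2
    have hxp : 0 < kreinRe J x x := by
      by_contra hneg
      push Not at hneg
      nlinarith [hA.2 x]
    have a1 : 0 ≤ (s - 1) ^ 2 * kreinRe J x x := by positivity
    have a2 : s ^ 2 * kreinRe J y y ≤ 0 := by nlinarith [sq_nonneg s]
    have a3 : (s - 1) ^ 2 * kreinRe J x x = 0 := by linarith
    have a4 : s ^ 2 * kreinRe J y y = 0 := by linarith
    have b1 : s - 1 = 0 := by simpa [hxp.ne'] using a3
    have b2 : s = 0 := by simpa [hy.ne] using a4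
    linarith
  have hp := pos_strict hJ hA hker hzs
  have hfs' : kreinRe J (A (z s)) (z s) = t * kreinRe J (z s) (z s) := by
    simp only [f] at hfs; linarith
  have hne : kreinRe J (z s) (z s) ≠ 0 := by
    intro h; rw [h] at hfs'; linarith
  exact ⟨z s, hne, by rw [hfs']; field_simp⟩

lemma oneSide {J A : K →L[ℂ] K} (hJ : IsFundamentalSymmetry J)
    (hA : IsKreinNonneg J A) (hker : ∀ x : K, A x = 0 → x = 0) (hind : KreinIndefinite J) :
    (sigmaR A ∩ Ioi 0).Nonempty ∧ 0 ≤ sInf (sigmaR A ∩ Ioi 0) ∧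
      (∀ t, 0 < t → t ∈ kreinW J A → sInf (sigmaR A ∩ Ioi 0) ≤ t) ∧
      (∀ t, sInf (sigmaR A ∩ Ioi 0) < t → t ∈ kreinW J A) := by
  have hbdd : BddBelow (sigmaR A ∩ Ioi 0) := ⟨0, fun t ht => ht.2.le⟩
  have hne : (sigmaR A ∩ Ioi 0).Nonempty := by
    by_contra hemp
    rw [Set.not_nonempty_iff_eq_empty] at hemp
    obtain ⟨x, hx⟩ := hind.1
    have h1 := gap hJ hA hker (ε := kreinRe J (A x) x / kreinRe J x x + 1)
      (by have := div_nonneg (hA.2 x) hx.le; linarith)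
      (fun t ht _ hm => by
        have : t ∈ sigmaR A ∩ Ioi 0 := ⟨hm, ht⟩
        rw [hemp] at this; exact this) x
    rw [add_mul, div_mul_cancel₀ _ hx.ne'] at h1
    linarith
  have h0 : 0 ≤ sInf (sigmaR A ∩ Ioi 0) := le_csInf hne fun t ht => ht.2.le
  refine ⟨hne, h0, ?_, ?_⟩
  · rintro t ht ⟨x, hx, rfl⟩
    by_contra hlt
    push Not at hlt
    have h1 := gap hJ hA hker (ε := sInf (sigmaR A ∩ Ioi 0)) h0
      (fun t ht hlt hm => absurd (csInf_le hbdd ⟨hm, ht⟩) (not_le.2 hlt)) x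
    have hxp : 0 < kreinRe J x x := by
      by_contra hc
      have := div_nonpos_of_nonneg_of_nonpos (hA.2 x) (not_lt.1 hc)
      linarith
    rw [div_lt_iff₀ hxp] at hlt
    linarith
  · intro t ht
    have htp : 0 < t := h0.trans_lt ht
    obtain ⟨s, hs, hst⟩ := exists_lt_of_csInf_lt hne ht
    by_contra hW
    refine gap_conv hJ hA (ε := t) (fun x => ?_) s hs.2 hst hs.1
    by_contra hx
    exact hW (mem_W hJ hA hker hind htp (not_le.1 hx))

end KreinAux

open KreinAux in
/-- Theorem (i): if `ker A = {0}`, then `μ₋ > -∞`, `μ₊ < ∞`, and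
`W(A) ∪ {μ₋, μ₊} = (-∞, μ₋] ∪ [μ₊, ∞)`. -/
theorem stmt_2 (J A : K →L[ℂ] K) (hJ : IsFundamentalSymmetry J)
    (hA : IsKreinNonneg J A) (hA0 : A ≠ 0) (hind : KreinIndefinite J)
    (hker : ∀ x : K, A x = 0 → x = 0) :
    (sigmaR A ∩ Set.Iio 0).Nonempty ∧ (sigmaR A ∩ Set.Ioi 0).Nonempty ∧
      kreinW J A ∪ {sSup (sigmaR A ∩ Set.Iio 0), sInf (sigmaR A ∩ Set.Ioi 0)} =
        Set.Iic (sSup (sigmaR A ∩ Set.Iio 0)) ∪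
          Set.Ici (sInf (sigmaR A ∩ Set.Ioi 0)) := by
  obtain ⟨p1, p2, p3, p4⟩ := oneSide hJ hA hker hind
  have kn : ∀ x y, kreinRe (-J) x y = - kreinRe J x y := fun x y => by simp [kreinRe]
  have kn2 : ∀ x y, kreinRe J (-x) y = - kreinRe J x y := fun x y => by simp [kreinRe]
  have hJ' : IsFundamentalSymmetry (-J) := ⟨hJ.1.neg, by simpa using hJ.2⟩
  have hA' : IsKreinNonneg (-J) (-A) := by
    refine ⟨by simpa using hA.1, fun x => ?_⟩
    simpa [kn, kn2] using hA.2 x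
  have hind' : KreinIndefinite (-J) := by
    obtain ⟨⟨x, hx⟩, y, hy⟩ := hind
    exact ⟨⟨y, by simpa [kn] using hy⟩, x, by simpa [kn] using hx⟩
  have hker' : ∀ x, (-A) x = 0 → x = 0 := fun x hx => hker x (by simpa using hx)
  have hs : sigmaR (-A) ∩ Ioi 0 = -(sigmaR A ∩ Iio 0) := by
    ext t
    simp [sigmaR, ← spectrum.neg_eq]
  have hW : ∀ t, t ∈ kreinW (-J) (-A) ↔ -t ∈ kreinW J A := by
    intro t
    simp only [kreinW, mem_ofPred_eq, kn, kn2, neg_apply, neg_neg,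
      ne_eq, neg_eq_zero, div_neg]
    refine exists_congr fun x => and_congr_right fun _ => ?_
    constructor <;> intro h <;> linarith
  obtain ⟨n1, n2, n3, n4⟩ := oneSide hJ' hA' hker' hind'
  rw [hs] at n1 n2 n3 n4
  rw [Real.sInf_neg] at n2 n3 n4
  refine ⟨Set.nonempty_neg.1 n1, p1, ?_⟩
  generalize sSup (sigmaR A ∩ Iio 0) = a at *
  generalize sInf (sigmaR A ∩ Ioi 0) = b at *
  have hW0 : (0 : ℝ) ∉ kreinW J A := by
    rintro ⟨x, hx, h⟩
    have hx0 : x ≠ 0 := by rintro rfl; simp [kreinRe] at hx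
    have := pos_strict hJ hA hker hx0
    rcases div_eq_zero_iff.1 h.symm with h | h
    · linarith
    · exact hx h
  ext r
  simp only [mem_union, mem_insert_iff, mem_singleton_iff, mem_Iic, mem_Ici]
  constructor
  · rintro (h | h | h)
    · rcases lt_trichotomy r 0 with hr | hr | hr
      · left
        have := n3 (-r) (by linarith) ((hW _).2 (by simpa using h))
        linarith
      · rw [hr] at h; exact absurd h hW0
      · right; exact p3 r hr h
    · left; exact h.le
    · right; exact h.ge
  · rintro (h | h)
    · rcases h.eq_or_lt with h | h
      · right; left; exact h
      · left
        have := (hW (-r)).1 (n4 (-r) (by linarith))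
        simpa using this
    · rcases h.eq_or_lt with h | h
      · right; right; exact h.symm
      · left; exact p4 r h
end

section
/- Let A ≠ 0 be a non-negative operator in the Krein space K, let K be indefinite, and assume that ker A ≠ {0} is positive. Then σℝ(A) ∩ (-∞,0) is nonempty (so μ₋ > -∞), and W(A) ∪ {μ₋} = (-∞, μ₋] ∪ [0, ∞). -/
open Set Filter Topology

variable {K : Type*} [NormedAddCommGroup K] [InnerProductSpace ℂ K] [CompleteSpace K]

/-- The real quadratic form of an operator. -/
noncomputable def qf (T : K →L[ℂ] K) (x : K) : ℝ := (@inner ℂ K _ (T x) x).re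

theorem qf_pencil (G J : K →L[ℂ] K) (r : ℝ) (x : K) :
    qf (G - (r : ℂ) • J) x = qf G x - r * qf J x := by
  simp [qf, inner_sub_left, inner_smul_left]

theorem qf_continuous (T : K →L[ℂ] K) : Continuous (qf T) := by
  unfold qf
  fun_prop

theorem qf_smul (T : K →L[ℂ] K) (c : ℝ) (x : K) :
    qf T ((c : ℂ) • x) = c ^ 2 * qf T x := by
  simp [qf, inner_smul_left, inner_smul_right]
  ring

theorem qf_ivt (T : K →L[ℂ] K) (u v : K) (hu : 0 < qf T u) (hv : qf T v ≤ 0) (hv0 : v ≠ 0) :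
    ∃ x, x ≠ 0 ∧ qf T x = 0 := by
  have hc : Continuous (fun t : ℝ => qf T ((t : ℂ) • u + ((1 - t : ℝ) : ℂ) • v)) := by
    refine (qf_continuous T).comp ?_
    fun_prop
  have h := intermediate_value_Icc (zero_le_one (α := ℝ)) hc.continuousOn
  obtain ⟨t, -, ht⟩ := h (show (0 : ℝ) ∈ _ by simpa using ⟨hv, hu.le⟩)
  refine ⟨_, ?_, ht⟩
  intro h0
  by_cases ht0 : t = 0
  · subst ht0
    simp at h0
    exact hv0 h0
  · have hu' : u = (((t - 1) / t : ℝ) : ℂ) • v := by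
      have htc : (t : ℂ) ≠ 0 := by exact_mod_cast ht0
      have h1 : (t : ℂ) • u = ((t - 1 : ℝ) : ℂ) • v := by
        rw [eq_neg_of_add_eq_zero_left h0, ← neg_smul]
        congr 1
        push_cast
        ring
      have h2 : u = (t : ℂ)⁻¹ • ((t : ℂ) • u) := by
        rw [smul_smul, inv_mul_cancel₀ htc, one_smul]
      rw [h2, h1, smul_smul]
      congr 1
      push_cast
      ring
    rw [hu', qf_smul] at hu
    nlinarith [sq_nonneg ((t - 1) / t)]

theorem exists_sqrt (T : K →L[ℂ] K) (hT : IsSelfAdjoint T) (hp : ∀ x, 0 ≤ qf T x) :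
    ∃ g : K →L[ℂ] K, IsSelfAdjoint g ∧ g * g = T := by
  have h : 0 ≤ T := by
    rw [ContinuousLinearMap.nonneg_iff_isPositive, ContinuousLinearMap.isPositive_def']
    exact ⟨hT, hp⟩
  exact ⟨CFC.sqrt T, IsSelfAdjoint.of_nonneg (CFC.sqrt_nonneg T), CFC.sqrt_mul_sqrt_self T h⟩

theorem sa_inner {T : K →L[ℂ] K} (hT : IsSelfAdjoint T) (x y : K) :
    @inner ℂ K _ (T x) y = @inner ℂ K _ x (T y) :=
  (ContinuousLinearMap.isSelfAdjoint_iff_isSymmetric.mp hT) x y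

theorem sq_qf {g : K →L[ℂ] K} (hg : IsSelfAdjoint g) (x : K) : qf (g * g) x = ‖g x‖ ^ 2 := by
  have : @inner ℂ K _ ((g * g) x) x = @inner ℂ K _ (g x) (g x) := sa_inner hg _ _
  rw [qf, this, inner_self_eq_norm_sq_to_K]
  norm_cast

theorem norm_sq_le (T : K →L[ℂ] K) (hT : IsSelfAdjoint T) (hp : ∀ x, 0 ≤ qf T x) :
    ∃ C : ℝ, 0 ≤ C ∧ ∀ x, ‖T x‖ ^ 2 ≤ C * qf T x := by
  obtain ⟨g, hg, rfl⟩ := exists_sqrt T hT hp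
  refine ⟨‖g‖ ^ 2, by positivity, fun x => ?_⟩
  rw [sq_qf hg, ← mul_pow]
  gcongr
  exact g.le_opNorm (g x)

theorem eq_zero_of_qf (T : K →L[ℂ] K) (hT : IsSelfAdjoint T) (hp : ∀ x, 0 ≤ qf T x) (x : K)
    (hx : qf T x = 0) : T x = 0 := by
  obtain ⟨C, -, h⟩ := norm_sq_le T hT hp
  have := h x
  rw [hx, mul_zero] at this
  have h2 : ‖T x‖ = 0 := by nlinarith [norm_nonneg (T x)]
  simpa using h2

theorem sa_pencil {G J : K →L[ℂ] K} (hG : IsSelfAdjoint G) (hJ : IsSelfAdjoint J) (r : ℝ) :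
    IsSelfAdjoint (G - (r : ℂ) • J) := by
  refine hG.sub (IsSelfAdjoint.smul ?_ hJ)
  simp [IsSelfAdjoint]

/-- Resolvent part. -/
theorem pencil_isUnit {G J : K →L[ℂ] K} (hG : IsSelfAdjoint G) (hJ : IsSelfAdjoint J)
    (hJJ : J * J = 1) (hGp : ∀ x, 0 ≤ qf G x) (r t : ℝ) (hrt : r < t) (ht : t < 0)
    (hr : ∀ x, 0 ≤ qf (G - (r : ℂ) • J) x) : IsUnit (G - (t : ℂ) • J) := by
  set B := G - (t : ℂ) • J with hB
  have hBsa : IsSelfAdjoint B := sa_pencil hG hJ t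
  have hr0 : r < 0 := hrt.trans ht
  set c := 1 - t / r with hc
  have hc0 : 0 < c := by
    have : t / r < 1 := by rw [div_lt_one_of_neg hr0]; exact hrt
    linarith
  have hBG : ∀ x, c * qf G x ≤ qf B x := by
    intro x
    have h1 := hr x
    rw [qf_pencil] at h1
    rw [hB, qf_pencil]
    have h2 : 0 < t / r := div_pos_of_neg_of_neg ht hr0
    have h3 : t = t / r * r := (div_mul_cancel₀ t hr0.ne).symm
    have h4 := mul_nonneg h2.le h1
    have h5 : t * qf J x = t / r * (r * qf J x) := by rw [← mul_assoc, ← h3]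
    rw [h5, hc]
    linarith
  have hBp : ∀ x, 0 ≤ qf B x := fun x => (mul_nonneg hc0.le (hGp x)).trans (hBG x)
  obtain ⟨C, hC, hCB⟩ := norm_sq_le B hBsa hBp
  obtain ⟨D, hD, hDG⟩ := norm_sq_le G hG hGp
  have hJn : ∀ x, ‖J x‖ ^ 2 = ‖x‖ ^ 2 := by
    intro x
    rw [← sq_qf hJ, hJJ, qf]
    simp only [one_apply_eq_self]
    rw [inner_self_eq_norm_sq_to_K]
    norm_cast
  have key : ∀ x, t ^ 2 * ‖x‖ ^ 2 ≤ 2 * (C + D / c + 1) * qf B x := by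
    intro x
    have h1 : ‖(t : ℂ) • J x‖ ≤ ‖G x‖ + ‖B x‖ := by
      have : (t : ℂ) • J x = G x - B x := by simp [hB]
      rw [this]
      exact norm_sub_le _ _
    rw [norm_smul] at h1
    have h1' : (‖(t : ℂ)‖ * ‖J x‖) ^ 2 ≤ (‖G x‖ + ‖B x‖) ^ 2 := by gcongr
    rw [mul_pow, hJn] at h1'
    have h2 : ‖(t : ℂ)‖ ^ 2 = t ^ 2 := by simp
    rw [h2] at h1'
    have h3 : D * qf G x ≤ D / c * qf B x := by
      calc D * qf G x = D / c * (c * qf G x) := by field_simp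
        _ ≤ _ := by gcongr; exact hBG x
    nlinarith [hCB x, hDG x, hBp x, sq_nonneg (‖G x‖ - ‖B x‖)]
  have hE : 0 < 2 * (C + D / c + 1) := by positivity
  set d : ℝ := t ^ 2 / (2 * (C + D / c + 1)) with hd
  have hd0 : 0 < d := by
    have : 0 < t ^ 2 := by nlinarith
    positivity
  refine ContinuousLinearMap.isUnit_of_forall_le_norm_inner_map B (c := ⟨d, hd0.le⟩) hd0 ?_
  intro x
  have h1 : d * ‖x‖ ^ 2 ≤ qf B x := by
    rw [hd, div_mul_eq_mul_div, div_le_iff₀ hE]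
    linarith [key x]
  have h2 : qf B x ≤ ‖@inner ℂ K _ (B x) x‖ := Complex.re_le_norm _
  have h3 : ‖x‖ ^ 2 * d ≤ ‖@inner ℂ K _ (B x) x‖ := by linarith
  exact h3

/-- Spectral part. -/
theorem pencil_nonneg {G J : K →L[ℂ] K} (hG : IsSelfAdjoint G) (hJ : IsSelfAdjoint J)
    (hJJ : J * J = 1) (hGp : ∀ x, 0 ≤ qf G x) (r : ℝ) (hr : r < 0)
    (hker : ∀ x : K, G x = 0 → x ≠ 0 → 0 < qf J x)
    (hs : ∀ t : ℝ, r ≤ t → t < 0 → (t : ℂ) ∉ spectrum ℂ (J * G)) :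
    ∀ x, 0 ≤ qf (G - (r : ℂ) • J) x := by
  obtain ⟨g, hg, hgG⟩ := exists_sqrt G hG hGp
  have hJJx : ∀ x, J (J x) = x := fun x => by
    rw [← mul_apply_eq_comp, hJJ, one_apply_eq_self]
  have hGx : ∀ x, G x = g (g x) := fun x => by rw [← hgG]; rfl
  set S := g * J * g with hS
  have hSsa : IsSelfAdjoint S := by
    rw [IsSelfAdjoint, hS, star_mul, star_mul, hg.star_eq, hJ.star_eq, mul_assoc]
  have hspec : ∀ t ∈ spectrum ℝ S, 0 ≤ t ^ 2 - r * t := by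
    intro t ht
    rw [← spectrum.algebraMap_mem_iff ℂ] at ht
    rcases le_or_gt 0 t with h0 | h0
    · nlinarith
    · have h1 : (t : ℂ) ∈ spectrum ℂ (J * G) := by
        have h2 := spectrum.nonzero_mul_comm (𝕜 := ℂ) g (J * g)
        have h3 : (t : ℂ) ∈ spectrum ℂ (g * (J * g)) \ {0} := by
          refine ⟨?_, by simpa using h0.ne⟩
          rw [← mul_assoc]
          exact ht
        rw [h2, mul_assoc, hgG] at h3
        exact h3.1
      have h4 : t < r := by
        by_contra h
        exact hs t (not_lt.mp h) h0 h1
      nlinarith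
  have hpos : 0 ≤ S ^ 2 - r • S := by
    have h1 : cfc (fun t : ℝ => t ^ 2 - r * t) S = S ^ 2 - r • S := by
      rw [cfc_sub (fun t : ℝ => t ^ 2) (fun t => r * t) S, cfc_pow_id S 2, cfc_const_mul_id r S]
    rw [← h1]
    exact cfc_nonneg hspec
  have hposq : ∀ z, 0 ≤ qf (S ^ 2 - r • S) z := by
    rw [ContinuousLinearMap.nonneg_iff_isPositive, ContinuousLinearMap.isPositive_def'] at hpos
    exact hpos.2
  set B := G - (r : ℂ) • J with hB
  have hBsa : IsSelfAdjoint B := sa_pencil hG hJ r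
  have hv : ∀ z, 0 ≤ qf B (J (g z)) := by
    intro z
    have h := hposq z
    have e1 : qf (S ^ 2 - r • S) z = qf G (J (g z)) - r * qf J (J (g z)) := by
      have a1 : @inner ℂ K _ ((S ^ 2) z) z = @inner ℂ K _ (G (J (g z))) (J (g z)) := by
        have : (S ^ 2) z = g (J (g (g (J (g z))))) := by
          rw [pow_two]; rfl
        rw [this, sa_inner hg, sa_inner hJ, hGx]
      have a2 : @inner ℂ K _ (S z) z = @inner ℂ K _ (J (J (g z))) (J (g z)) := by
        have : S z = g (J (g z)) := rfl
        rw [this, sa_inner hg, hJJx, sa_inner hJ]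
      have a3 : ((r • S) z) = (r : ℂ) • S z := by simp
      simp only [qf]
      rw [sub_apply, a3, inner_sub_left, inner_smul_left, a1, a2]
      simp
    rw [hB, qf_pencil, ← e1]
    exact h
  let D : Submodule ℂ K := LinearMap.ker (G : K →ₗ[ℂ] K) ⊔ LinearMap.range ((J * g : K →L[ℂ] K) : K →ₗ[ℂ] K)
  have hD : Dense (D : Set K) := by
    rw [Submodule.dense_iff_topologicalClosure_eq_top, Submodule.topologicalClosure_eq_top_iff,
      Submodule.eq_bot_iff]
    intro u hu
    rw [Submodule.mem_orthogonal] at hu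
    have h1 : g (J u) = 0 := by
      have := hu (J (g (g (J u)))) (Submodule.mem_sup_right ⟨g (J u), rfl⟩)
      rw [sa_inner hJ, sa_inner hg] at this
      simpa using this
    have h2 : G (J u) = 0 := by rw [hGx, h1, map_zero]
    have h3 := hu (J u) (Submodule.mem_sup_left h2)
    by_contra hne
    have h4 : J u ≠ 0 := fun h => hne (by rw [← hJJx u, h, map_zero])
    have h5 := hker _ h2 h4
    rw [qf, sa_inner hJ, hJJx, h3] at h5
    simp at h5
  have hDB : ∀ x ∈ D, 0 ≤ qf B x := by
    intro x hx
    obtain ⟨n, hn, v, ⟨z, hz⟩, rfl⟩ := Submodule.mem_sup.mp hx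
    have hn' : G n = 0 := hn
    have hz' : v = J (g z) := hz.symm
    have hgn : g n = 0 := by
      have := sq_qf hg n
      rw [hgG, qf, hn'] at this
      simp at this
      exact norm_eq_zero.mp (pow_eq_zero_iff two_ne_zero |>.mp this.symm)
    have c1 : @inner ℂ K _ (B n) v = 0 := by
      have : B n = -((r : ℂ) • J n) := by simp [hB, hn']
      rw [this, inner_neg_left, inner_smul_left, hz', sa_inner hJ, hJJx, ← sa_inner hg, hgn]
      simp
    have c2 : @inner ℂ K _ (B v) n = 0 := by
      rw [sa_inner hBsa, ← inner_conj_symm, c1, map_zero]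
    have c3 : qf B (n + v) = qf B n + qf B v := by
      simp only [qf, map_add, inner_add_left, inner_add_right, c1, c2]
      simp
    have c4 : 0 ≤ qf B n := by
      have hq : qf G n = 0 := by simp [qf, hn']
      rw [hB, qf_pencil, hq]
      by_cases h0 : n = 0
      · simp [h0, qf]
      · nlinarith [hker n hn' h0]
    rw [c3]
    have := hv z
    rw [← hz'] at this
    linarith
  intro x
  have hcl : IsClosed {x | 0 ≤ qf B x} := isClosed_le continuous_const (qf_continuous B)
  exact hcl.closure_subset_iff.mpr hDB (hD x)

/-- Theorem (iii): if `ker A ≠ {0}` is positive, then `μ₋ > -∞` and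
`W(A) ∪ {μ₋} = (-∞, μ₋] ∪ [0, ∞)`. -/
theorem stmt_4 (J A : K →L[ℂ] K) (hJ : IsFundamentalSymmetry J)
    (hA : IsKreinNonneg J A) (hA0 : A ≠ 0) (hind : KreinIndefinite J)
    (hker_ne : ∃ x : K, x ≠ 0 ∧ A x = 0)
    (hker_pos : ∀ x : K, A x = 0 → x ≠ 0 → 0 < kreinRe J x x) :
    (sigmaR A ∩ Set.Iio 0).Nonempty ∧
      kreinW J A ∪ {sSup (sigmaR A ∩ Set.Iio 0)} =
        Set.Iic (sSup (sigmaR A ∩ Set.Iio 0)) ∪ Set.Ici 0 := by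
  obtain ⟨hJs, hJJ⟩ := hJ
  obtain ⟨hG, hGp⟩ := hA
  have hJJ' : J * J = 1 := hJJ
  set G : K →L[ℂ] K := J ∘L A with hGdef
  have hJJx : ∀ x, J (J x) = x := fun x => by
    rw [← mul_apply_eq_comp, hJJ', one_apply_eq_self]
  have hGA : ∀ x, kreinRe J (A x) x = qf G x := fun x => rfl
  have hJq : ∀ x, kreinRe J x x = qf J x := fun x => rfl
  have hGp' : ∀ x, 0 ≤ qf G x := hGp
  have hJG : J * G = A := by
    have : J * G = J * J * A := by rw [mul_assoc]; rfl
    rw [this, hJJ', one_mul]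
  have hker : ∀ x : K, G x = 0 → x ≠ 0 → 0 < qf J x := by
    intro x hx hx0
    refine hker_pos x ?_ hx0
    rw [← hJG, mul_apply_eq_comp, hx, map_zero]
  obtain ⟨n, hn0, hn⟩ := hker_ne
  have hGn : G n = 0 := by
    change J (A n) = 0
    rw [hn, map_zero]
  have hnJ : 0 < qf J n := hker n hGn hn0
  have hnG : qf G n = 0 := by simp [qf, hGn]
  obtain ⟨-, y, hy⟩ := hind
  rw [hJq] at hy
  have hy0 : y ≠ 0 := by
    rintro rfl
    simp [qf] at hy
  have hGy : 0 < qf G y := by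
    refine lt_of_le_of_ne (hGp' y) fun h => ?_
    have := hker y (eq_zero_of_qf G hG hGp' y h.symm) hy0
    linarith
  have hmem : ∀ r : ℝ, ∀ x, x ≠ 0 → qf (G - (r : ℂ) • J) x = 0 → r ∈ kreinW J A := by
    intro r x hx0 hx
    rw [qf_pencil] at hx
    have hne : qf J x ≠ 0 := by
      intro h
      rw [h, mul_zero, sub_zero] at hx
      have := hker x (eq_zero_of_qf G hG hGp' x hx) hx0
      linarith
    refine ⟨x, hne, ?_⟩
    rw [hGA, hJq, eq_div_iff hne]
    linarith
  have hunit : ∀ r : ℝ, (r : ℂ) ∈ spectrum ℂ A ↔ ¬ IsUnit (G - (r : ℂ) • J) := by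
    intro r
    have hJu : IsUnit J := ⟨⟨J, J, hJJ', hJJ'⟩, rfl⟩
    rw [spectrum.mem_iff, ← IsUnit.neg_iff]
    have : -((algebraMap ℂ (K →L[ℂ] K)) (r : ℂ) - A) = J * (G - (r : ℂ) • J) := by
      rw [mul_sub, hJG, mul_smul_comm, hJJ', neg_sub, Algebra.algebraMap_eq_smul_one]
    rw [this, hJu.mul_left_iff]
  -- elements of W below zero see spectrum to their right
  have hW : ∀ r ∈ kreinW J A, r < 0 → ∃ t ∈ sigmaR A ∩ Set.Iio 0, r ≤ t := by
    intro r ⟨x, hx, hrx⟩ hr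
    by_contra hcon
    push Not at hcon
    have hs : ∀ t : ℝ, r ≤ t → t < 0 → (t : ℂ) ∉ spectrum ℂ A :=
      fun t h1 h2 h3 => absurd h1 (not_le.mpr (hcon t ⟨h3, h2⟩))
    have hp := pencil_nonneg hG hJs hJJ' hGp' r hr hker (by rw [hJG]; exact hs)
    have hu : IsUnit (G - (r : ℂ) • J) := by
      by_contra h
      exact hs r le_rfl hr ((hunit r).mpr h)
    rw [hGA, hJq] at hrx
    rw [hJq] at hx
    have hq : qf (G - (r : ℂ) • J) x = 0 := by
      rw [qf_pencil, hrx, div_mul_cancel₀ _ hx, sub_self]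
    have hz := eq_zero_of_qf _ (sa_pencil hG hJs r) hp x hq
    obtain ⟨u, hu⟩ := hu
    have : x = 0 := by
      have h1 : ((↑u⁻¹ : K →L[ℂ] K) * (u : K →L[ℂ] K)) x = x := by
        rw [Units.inv_mul, one_apply_eq_self]
      rw [← h1, mul_apply_eq_comp, hu, hz, map_zero]
    rw [this] at hx
    simp [qf] at hx
  have hne : (sigmaR A ∩ Set.Iio 0).Nonempty := by
    obtain ⟨t, ht, -⟩ := hW (qf G y / qf J y) ⟨y, hy.ne, rfl⟩ (div_neg_of_pos_of_neg hGy hy)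
    exact ⟨t, ht⟩
  have hbdd : BddAbove (sigmaR A ∩ Set.Iio 0) := ⟨0, fun t ht => le_of_lt ht.2⟩
  refine ⟨hne, Set.Subset.antisymm ?_ ?_⟩
  · rintro r (hr | hr)
    · rcases lt_or_ge r 0 with h | h
      · obtain ⟨t, ht, hrt⟩ := hW r hr h
        exact Or.inl (hrt.trans (le_csSup hbdd ht))
      · exact Or.inr h
    · exact Or.inl (le_of_eq hr)
  · rintro r (hr | hr)
    · rcases eq_or_lt_of_le (show r ≤ _ from hr) with h | h
      · exact Or.inr h
      · left
        obtain ⟨t, ht, hrt⟩ := exists_lt_of_lt_csSup hne h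
        have ht0 : t < 0 := ht.2
        have hnot : ¬ ∀ x, 0 ≤ qf (G - (r : ℂ) • J) x := fun hp =>
          (hunit t).mp ht.1 (pencil_isUnit hG hJs hJJ' hGp' r t hrt ht0 hp)
        push Not at hnot
        obtain ⟨v, hv⟩ := hnot
        obtain ⟨x, hx0, hx⟩ := qf_ivt (G - (r : ℂ) • J) n v
          (by rw [qf_pencil, hnG]; nlinarith) hv.le (by rintro rfl; simp [qf] at hv)
        exact hmem r x hx0 hx
    · left
      obtain ⟨x, hx0, hx⟩ := qf_ivt (G - (r : ℂ) • J) y n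
          (by rw [qf_pencil]; nlinarith [show (0 : ℝ) ≤ r from hr])
          (by rw [qf_pencil, hnG]; nlinarith [show (0 : ℝ) ≤ r from hr]) hn0
      exact hmem r x hx0 hx
end

section
/- Let A ≠ 0 be a non-negative operator in the Krein space K, let K be indefinite, and assume that ker A ≠ {0} is negative. Then σℝ(A) ∩ (0,∞) is nonempty (so μ₊ < ∞), and W(A) ∪ {μ₊} = (-∞, 0] ∪ [μ₊, ∞). -/
open Set Filter Topology

variable {K : Type*} [NormedAddCommGroup K] [InnerProductSpace ℂ K] [CompleteSpace K]

open scoped InnerProductSpace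

theorem aux_sqrt (T : K →L[ℂ] K) (hT : IsSelfAdjoint T)
    (h : ∀ x : K, 0 ≤ (⟪T x, x⟫_ℂ).re) :
    ∃ R : K →L[ℂ] K, IsSelfAdjoint R ∧ R * R = T := by
  have h0 : (0 : K →L[ℂ] K) ≤ T := by
    rw [ContinuousLinearMap.nonneg_iff_isPositive, ContinuousLinearMap.isPositive_def']
    exact ⟨hT, h⟩
  exact ⟨CFC.sqrt T, (CFC.sqrt_nonneg T).isSelfAdjoint, CFC.sqrt_mul_sqrt_self T h0⟩

theorem aux_symm {T : K →L[ℂ] K} (hT : IsSelfAdjoint T) (x y : K) :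
    ⟪T x, y⟫_ℂ = ⟪x, T y⟫_ℂ :=
  (ContinuousLinearMap.isSelfAdjoint_iff_isSymmetric.mp hT) x y

theorem aux_bound (T : K →L[ℂ] K) (hT : IsSelfAdjoint T)
    (h : ∀ x : K, 0 ≤ (⟪T x, x⟫_ℂ).re) :
    ∃ C : ℝ, 0 < C ∧ ∀ x : K, ‖T x‖ ^ 2 ≤ C * (⟪T x, x⟫_ℂ).re := by
  obtain ⟨R, hR, rfl⟩ := aux_sqrt T hT h
  refine ⟨‖R‖ ^ 2 + 1, by positivity, fun x => ?_⟩
  have h1 : (⟪(R * R) x, x⟫_ℂ).re = ‖R x‖ ^ 2 := by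
    rw [mul_apply_eq_comp, aux_symm hR]
    exact inner_self_eq_norm_sq (𝕜 := ℂ) (R x)
  rw [h1, mul_apply_eq_comp]
  have h2 := R.le_opNorm (R x)
  have h3 : ‖R (R x)‖ ^ 2 ≤ (‖R‖ * ‖R x‖) ^ 2 := by gcongr
  nlinarith [sq_nonneg ‖R x‖]

/-- If `G ≥ m J` then there is no spectrum in `(0, m)`. -/
theorem aux_resolvent (J A : K →L[ℂ] K) (hJ : IsFundamentalSymmetry J)
    (hA : IsKreinNonneg J A) (m : ℝ)
    (h : ∀ x : K, m * kreinRe J x x ≤ kreinRe J (A x) x) (t : ℝ) (ht0 : 0 < t) (htm : t < m) :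
    t ∉ sigmaR A := by
  obtain ⟨hJs, hJJ⟩ := hJ
  obtain ⟨hGs, hG⟩ := hA
  have hJJ' : ∀ x, J (J x) = x := fun x => by
    have := congrArg (fun T : K →L[ℂ] K => T x) hJJ
    simpa using this
  have hm : 0 < m := ht0.trans htm
  obtain ⟨C, hC, hCb⟩ := aux_bound (J ∘L A) hGs hG
  have hQs : IsSelfAdjoint (J ∘L A - m • J) := hGs.sub (IsSelfAdjoint.smul (by simp [IsSelfAdjoint]) hJs)
  have hQre : ∀ (s : ℝ) (x : K), (⟪(J ∘L A - s • J) x, x⟫_ℂ).re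
      = kreinRe J (A x) x - s * kreinRe J x x := by
    intro s x
    simp [kreinRe, inner_sub_left, inner_smul_left_eq_smul]
  obtain ⟨D, hD, hDb⟩ := aux_bound (J ∘L A - m • J) hQs (fun x => by
    rw [hQre]; linarith [h x])
  have hunit : IsUnit (J ∘L A - t • J) := by
    set a : ℝ := 1 - t / m
    set b : ℝ := t / m
    have hb : 0 < b := by positivity
    have ha : 0 < a := by
      have : t / m < 1 := (div_lt_one hm).2 htm
      simp only [a]; linarith
    set M : ℝ := 2 * (C / a + D / b)
    have hM : 0 < M := by positivity
    have hc : 0 < m ^ 2 / M := by positivity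
    refine ContinuousLinearMap.isUnit_of_forall_le_norm_inner_map _ (c := ⟨m ^ 2 / M, hc.le⟩) hc ?_
    intro x
    refine le_trans ?_ (Complex.re_le_norm _)
    rw [hQre]
    have e1 := hCb x
    have e2 := hDb x
    rw [hQre] at e2
    have e1' : ‖J (A x)‖ ^ 2 ≤ C * kreinRe J (A x) x := e1
    have e3 : m * ‖x‖ ≤ ‖J (A x)‖ + ‖(J ∘L A - m • J) x‖ := by
      have k1 : m • J x = J (A x) - (J ∘L A - m • J) x := by simp
      have k2 : ‖J x‖ = ‖x‖ := by
        have : ⟪J x, J x⟫_ℂ = ⟪x, x⟫_ℂ := by rw [aux_symm hJs, hJJ']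
        rw [@norm_eq_sqrt_re_inner ℂ, @norm_eq_sqrt_re_inner ℂ _ _ _ _ x, this]
      calc m * ‖x‖ = ‖m • J x‖ := by rw [norm_smul, k2, Real.norm_of_nonneg hm.le]
        _ ≤ _ := by rw [k1]; exact norm_sub_le _ _
    set p := kreinRe J (A x) x
    set q := kreinRe J x x
    have hp : 0 ≤ p := hG x
    have hq : 0 ≤ p - m * q := by linarith [h x]
    have e4 : p - t * q = a * p + b * (p - m * q) := by
      simp only [a, b]; field_simp; ring
    have e5 : (m * ‖x‖) ^ 2 ≤ 2 * (C * p + D * (p - m * q)) := by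
      have : (m * ‖x‖) ^ 2 ≤ (‖J (A x)‖ + ‖(J ∘L A - m • J) x‖) ^ 2 := by gcongr
      nlinarith [sq_nonneg (‖J (A x)‖ - ‖(J ∘L A - m • J) x‖)]
    have e6 : 2 * (C * p + D * (p - m * q)) ≤ M * (a * p + b * (p - m * q)) := by
      have : M * (a * p + b * (p - m * q)) = 2 * (C * p + D * (p - m * q))
          + 2 * ((D / b) * a * p + (C / a) * b * (p - m * q)) := by
        simp only [M]
        have := ha.ne'
        have := hb.ne'
        field_simp
        ring
      rw [this]
      have : 0 ≤ (D / b) * a * p + (C / a) * b * (p - m * q) := by positivity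
      linarith
    rw [e4]
    change ‖x‖ ^ 2 * (m ^ 2 / M) ≤ _
    rw [← mul_div_assoc, div_le_iff₀ hM]
    nlinarith
  have hJu : IsUnit J := ⟨⟨J, J, hJJ, hJJ⟩, rfl⟩
  intro hmem
  refine hmem ?_
  have hu := (hJu.mul hunit).neg
  have he : algebraMap ℂ (K →L[ℂ] K) (t : ℂ) - A = -(J * (J ∘L A - t • J)) := by
    ext x
    simp [hJJ', Algebra.algebraMap_eq_smul_one]
  rw [← he] at hu
  exact hu

/-- If there is no spectrum in `(0, ε)` then `G ≥ ε J`. -/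
theorem aux_lower (J A : K →L[ℂ] K) (hJ : IsFundamentalSymmetry J)
    (hA : IsKreinNonneg J A)
    (hker_neg : ∀ x : K, A x = 0 → x ≠ 0 → kreinRe J x x < 0) (ε : ℝ) (hε : 0 < ε)
    (h : ∀ t ∈ sigmaR A, 0 < t → ε ≤ t) (x : K) :
    ε * kreinRe J x x ≤ kreinRe J (A x) x := by
  obtain ⟨hJs, hJJ⟩ := hJ
  obtain ⟨hGs, hG⟩ := hA
  have hJJ' : ∀ x, J (J x) = x := fun x => by
    have := congrArg (fun T : K →L[ℂ] K => T x) hJJ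
    simpa using this
  have hGs' : ∀ x y, ⟪J (A x), y⟫_ℂ = ⟪x, J (A y)⟫_ℂ := fun x y => aux_symm hGs x y
  have hJs' : ∀ x y, ⟪J x, y⟫_ℂ = ⟪x, J y⟫_ℂ := fun x y => aux_symm hJs x y
  obtain ⟨R, hR, hRR⟩ := aux_sqrt (J ∘L A) hGs hG
  have hRR' : ∀ x, R (R x) = J (A x) := fun x => by
    have := congrArg (fun T : K →L[ℂ] K => T x) hRR
    simpa using this
  have hR' : ∀ x y, ⟪R x, y⟫_ℂ = ⟪x, R y⟫_ℂ := fun x y => aux_symm hR x y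
  have hAeq : (J * R) * R = A := by
    ext x; simp [hRR', hJJ']
  set S : K →L[ℂ] K := R * (J * R) with hS
  have hSs : IsSelfAdjoint S := by
    rw [IsSelfAdjoint, hS, star_mul, star_mul, hR.star_eq, hJs.star_eq, mul_assoc]
  have hspec : ∀ t ∈ spectrum ℝ S, 0 < t → ε ≤ t := by
    intro t ht ht0
    refine h t ?_ ht0
    have h1 : (t : ℂ) ∈ spectrum ℂ S \ {0} := by
      refine ⟨(spectrum.algebraMap_mem_iff ℂ).2 ht, ?_⟩
      simpa using ht0.ne'
    rw [hS, ← spectrum.nonzero_mul_comm, hAeq] at h1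
    exact h1.1
  have hpos : 0 ≤ S * S - ε • S := by
    have e : cfc (fun t : ℝ => t * t - ε * t) S = S * S - ε • S := by
      rw [cfc_sub (fun t : ℝ => t * t) (fun t : ℝ => ε * t) S, cfc_mul (fun t : ℝ => t) (fun t : ℝ => t) S,
        cfc_const_mul ε (fun t : ℝ => t) S, cfc_id' ℝ S]
    rw [← e]
    refine cfc_nonneg fun t ht => ?_
    rcases le_or_gt t 0 with h0 | h0
    · nlinarith
    · nlinarith [hspec t ht h0]
  have hSq : ∀ u, ε * (⟪S u, u⟫_ℂ).re ≤ (⟪S u, S u⟫_ℂ).re := by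
    intro u
    rw [ContinuousLinearMap.nonneg_iff_isPositive] at hpos
    have h1 : 0 ≤ (⟪(S * S - ε • S) u, u⟫_ℂ).re := hpos.re_inner_nonneg_left u
    have h2 : (⟪(S * S - ε • S) u, u⟫_ℂ).re = (⟪S (S u), u⟫_ℂ).re - ε * (⟪S u, u⟫_ℂ).re := by
      simp [inner_sub_left, inner_smul_left_eq_smul]
    rw [h2, aux_symm hSs (S u) u] at h1
    linarith
  have hran : ∀ y, ε * kreinRe J (A y) (A y) ≤ kreinRe J (A (A y)) (A y) := by
    intro y
    have h1 := hSq (R y)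
    have h2 : S (R y) = R (A y) := by
      simp [hS, hRR', hJJ']
    rw [h2, hR', hRR', hR', hRR', ← hJs' (A y) (A y), ← hGs'] at h1
    exact h1
  let L : Submodule ℂ K := A.ker ⊔ A.range
  have hL : ∀ x ∈ L, ε * kreinRe J x x ≤ kreinRe J (A x) x := by
    intro x hx
    obtain ⟨k, hk, z, ⟨y, rfl⟩, rfl⟩ := Submodule.mem_sup.1 hx
    have hk0 : A k = 0 := hk
    have c1 : ⟪J k, A y⟫_ℂ = 0 := by
      rw [hJs', ← hGs', hk0]; simp
    have c2 : ⟪J (A y), k⟫_ℂ = 0 := by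
      rw [hGs', hk0]; simp
    have c3 : ⟪J (A (A y)), k⟫_ℂ = 0 := by
      rw [hGs', hk0]; simp
    have d1 : kreinRe J (k + A y) (k + A y) = kreinRe J k k + kreinRe J (A y) (A y) := by
      simp [kreinRe, inner_add_left, inner_add_right, c1, c2]
    have d2 : kreinRe J (A (k + A y)) (k + A y) = kreinRe J (A (A y)) (A y) := by
      simp [kreinRe, inner_add_right, c3, hk0]
    have d3 : kreinRe J k k ≤ 0 := by
      by_cases hk' : k = 0
      · simp [hk', kreinRe]
      · exact (hker_neg k hk0 hk').le
    change ε * kreinRe J (k + A y) (k + A y) ≤ kreinRe J (A (k + A y)) (k + A y)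
    rw [d1, d2]
    nlinarith [hran y]
  have hdense : L.topologicalClosure = ⊤ := by
    rw [Submodule.topologicalClosure_eq_top_iff, Submodule.eq_bot_iff]
    intro z hz
    rw [Submodule.mem_orthogonal] at hz
    have h1 : A (J z) = 0 := by
      have : J (A (J z)) = 0 := by
        refine ext_inner_left ℂ fun y => ?_
        have := hz (A y) (Submodule.mem_sup_right ⟨y, rfl⟩)
        rw [← hGs', hJs', hJJ', this]; simp
      have h2 := hJJ' (A (J z))
      rw [this] at h2
      simpa using h2.symm
    by_contra hz0
    have hJz : J z ≠ 0 := by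
      intro h0
      apply hz0
      rw [← hJJ' z, h0]; simp
    have h3 := hker_neg _ h1 hJz
    have h4 := hz (J z) (Submodule.mem_sup_left h1)
    rw [kreinRe, hJs', hJJ', h4] at h3
    simp at h3
  have hx : x ∈ closure (L : Set K) := by
    have : x ∈ L.topologicalClosure := by rw [hdense]; trivial
    exact this
  refine le_on_closure (f := fun x => ε * kreinRe J x x) (g := fun x => kreinRe J (A x) x)
    hL ?_ ?_ hx
  · unfold kreinRe; fun_prop
  · unfold kreinRe; fun_prop

theorem aux_ivt (J A : K →L[ℂ] K) (hJ : IsFundamentalSymmetry J)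
    (hA : IsKreinNonneg J A)
    (hker_neg : ∀ x : K, A x = 0 → x ≠ 0 → kreinRe J x x < 0) (r : ℝ) (u v : K)
    (hu : kreinRe J (A u) u - r * kreinRe J u u < 0)
    (hv : 0 < kreinRe J (A v) v - r * kreinRe J v v) : r ∈ kreinW J A := by
  obtain ⟨hJs, hJJ⟩ := hJ
  obtain ⟨hGs, hG⟩ := hA
  have hJJ' : ∀ x, J (J x) = x := fun x => by
    have := congrArg (fun T : K →L[ℂ] K => T x) hJJ
    simpa using this
  obtain ⟨C, hC, hCb⟩ := aux_bound (J ∘L A) hGs hG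
  let f : K → ℝ := fun x => kreinRe J (A x) x - r * kreinRe J x x
  have hf : Continuous f := by
    simp only [f]; unfold kreinRe; fun_prop
  have hfs : ∀ (c : ℝ) x, f (c • x) = c ^ 2 * f x := by
    intro c x
    simp [f, kreinRe, inner_smul_left_eq_smul, inner_smul_right_eq_smul]
    ring
  let g : ℝ → K := fun s => (1 - s) • u + s • v
  have hg : Continuous g := by fun_prop
  have hiv := intermediate_value_Icc (zero_le_one (α := ℝ)) (hf.comp hg).continuousOn
  obtain ⟨s, hs, hs0⟩ := hiv (show (0 : ℝ) ∈ _ by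
    constructor
    · simpa [g, f] using hu.le
    · simpa [g, f] using hv.le)
  have hz0 : g s ≠ 0 := by
    intro h0
    have h1 : (1 - s) • u = (-s) • v := by
      rw [neg_smul]; exact eq_neg_of_add_eq_zero_left h0
    have h2 := congrArg f h1
    rw [hfs, hfs] at h2
    have hu' : f u < 0 := hu
    have hv' : 0 < f v := hv
    have h3 : (-s) ^ 2 * f v ≤ 0 := by
      rw [← h2]; nlinarith [sq_nonneg (1 - s)]
    have h4 : s = 0 := by
      by_contra hs
      have : 0 < (-s) ^ 2 := by rw [neg_sq]; positivity
      nlinarith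
    subst h4
    simp at h2
    linarith
  have hs0' : kreinRe J (A (g s)) (g s) - r * kreinRe J (g s) (g s) = 0 := hs0
  have hne : kreinRe J (g s) (g s) ≠ 0 := by
    intro h0
    rw [h0] at hs0'
    have h1 : ‖J (A (g s))‖ ^ 2 ≤ C * kreinRe J (A (g s)) (g s) := hCb (g s)
    have h2 : kreinRe J (A (g s)) (g s) = 0 := by linarith
    rw [h2, mul_zero] at h1
    have h3 : J (A (g s)) = 0 := by
      rw [← norm_eq_zero]
      exact pow_eq_zero_iff (two_ne_zero) |>.1 (le_antisymm h1 (sq_nonneg _))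
    have h4 := hJJ' (A (g s))
    rw [h3, map_zero] at h4
    have := hker_neg _ h4.symm hz0
    linarith
  refine ⟨g s, hne, ?_⟩
  rw [eq_div_iff hne]
  linarith

/-- Theorem (iv): if `ker A ≠ {0}` is negative, then `μ₊ < ∞` and
`W(A) ∪ {μ₊} = (-∞, 0] ∪ [μ₊, ∞)`. -/
theorem stmt_5 (J A : K →L[ℂ] K) (hJ : IsFundamentalSymmetry J)
    (hA : IsKreinNonneg J A) (hA0 : A ≠ 0) (hind : KreinIndefinite J)
    (hker_ne : ∃ x : K, x ≠ 0 ∧ A x = 0)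
    (hker_neg : ∀ x : K, A x = 0 → x ≠ 0 → kreinRe J x x < 0) :
    (sigmaR A ∩ Set.Ioi 0).Nonempty ∧
      kreinW J A ∪ {sInf (sigmaR A ∩ Set.Ioi 0)} =
        Set.Iic 0 ∪ Set.Ici (sInf (sigmaR A ∩ Set.Ioi 0)) := by
  obtain ⟨⟨xp, hxp⟩, -⟩ := hind
  obtain ⟨k, hk0, hk⟩ := hker_ne
  have hkneg := hker_neg k hk hk0
  have hG := hA.2
  have hkk : kreinRe J (A k) k = 0 := by simp [kreinRe, hk]
  have hne : (sigmaR A ∩ Set.Ioi 0).Nonempty := by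
    by_contra hemp
    rw [Set.not_nonempty_iff_eq_empty] at hemp
    have h1 : 0 < (kreinRe J (A xp) xp + 1) / kreinRe J xp xp := by
      have := hG xp
      positivity
    have h2 := aux_lower J A hJ hA hker_neg _ h1 (fun t ht ht0 => by
      have : t ∈ sigmaR A ∩ Set.Ioi 0 := ⟨ht, ht0⟩
      rw [hemp] at this
      exact this.elim) xp
    rw [div_mul_cancel₀ _ hxp.ne'] at h2
    linarith
  refine ⟨hne, ?_⟩
  set μ := sInf (sigmaR A ∩ Set.Ioi 0) with hμ
  have hbdd : BddBelow (sigmaR A ∩ Set.Ioi 0) := ⟨0, fun t ht => le_of_lt ht.2⟩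
  have hμ0 : 0 ≤ μ := le_csInf hne fun t ht => le_of_lt ht.2
  ext r
  constructor
  · rintro (⟨x, hx, rfl⟩ | hr)
    · rcases lt_or_gt_of_ne hx with h | h
      · left
        exact div_nonpos_of_nonneg_of_nonpos (hG x) h.le
      · right
        change μ ≤ _
        rcases hμ0.eq_or_lt with h0 | h0
        · rw [← h0]; exact div_nonneg (hG x) h.le
        · rw [le_div_iff₀ h]
          exact aux_lower J A hJ hA hker_neg μ h0 (fun t ht ht0 => csInf_le hbdd ⟨ht, ht0⟩) x
    · right
      exact (Set.mem_singleton_iff.1 hr).ge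
  · intro hr
    rcases eq_or_ne r μ with rfl | hrμ
    · right; rfl
    left
    rcases hr with hr | hr
    · rcases (show r ≤ 0 from hr).eq_or_lt with rfl | hr
      · exact ⟨k, hkneg.ne, by simp [hkk]⟩
      · refine aux_ivt J A hJ hA hker_neg r k xp ?_ ?_
        · rw [hkk]; nlinarith
        · nlinarith [hG xp]
    · have hr' : μ < r := lt_of_le_of_ne hr hrμ.symm
      obtain ⟨s, ⟨hs, hs0⟩, hsr⟩ := exists_lt_of_csInf_lt hne hr'
      have : ∃ x : K, kreinRe J (A x) x < r * kreinRe J x x := by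
        by_contra! hcon
        exact aux_resolvent J A hJ hA r hcon s hs0 hsr hs
      obtain ⟨u, hu⟩ := this
      refine aux_ivt J A hJ hA hker_neg r u k (by linarith) ?_
      rw [hkk]
      nlinarith
end

section
/- Let A ≠ 0 be a non-negative operator in the Krein space K and let K be indefinite. (1) If ker A = {0} or ker A ≠ {0} is positive, and σℝ(A) ∩ (-∞,0) ≠ ∅, then μ₋ ∈ W(A) if and only if there exists x ≠ 0 with A x = μ₋ • x. (2) If ker A = {0} or ker A ≠ {0} is negative, and σℝ(A) ∩ (0,∞) ≠ ∅, then μ₊ ∈ W(A) if and only if there exists x ≠ 0 with A x = μ₊ • x. -/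
open Set Filter Topology

variable {K : Type*} [NormedAddCommGroup K] [InnerProductSpace ℂ K] [CompleteSpace K]

/-- A positive operator has a selfadjoint square root. -/
lemma pos_sqrt (T : K →L[ℂ] K) (hT : IsSelfAdjoint T)
    (hpos : ∀ x : K, 0 ≤ (@inner ℂ K _ (T x) x).re) :
    ∃ S : K →L[ℂ] K, (∀ x y : K, @inner ℂ K _ (S x) y = @inner ℂ K _ x (S y)) ∧
      S * S = T ∧ IsSelfAdjoint S := by
  have hT0 : (0 : K →L[ℂ] K) ≤ T := by
    rw [ContinuousLinearMap.nonneg_iff_isPositive, ContinuousLinearMap.isPositive_def']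
    exact ⟨hT, hpos⟩
  have hS : IsSelfAdjoint (CFC.sqrt T) := IsSelfAdjoint.of_nonneg (CFC.sqrt_nonneg T)
  refine ⟨CFC.sqrt T, fun x y => ?_, CFC.sqrt_mul_sqrt_self T hT0, hS⟩
  exact hS.isSymmetric x y

lemma pos_zero (T : K →L[ℂ] K) (hT : IsSelfAdjoint T)
    (hpos : ∀ x : K, 0 ≤ (@inner ℂ K _ (T x) x).re) (x : K)
    (hx : (@inner ℂ K _ (T x) x).re = 0) : T x = 0 := by
  obtain ⟨S, hS, hSS, -⟩ := pos_sqrt T hT hpos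
  have h1 : T x = S (S x) := by rw [← hSS]; rfl
  rw [h1, hS] at hx
  have h2 : S x = 0 := by
    have h3 : (@inner ℂ K _ (S x) (S x)).re = ‖S x‖ ^ 2 :=
      inner_self_eq_norm_sq (𝕜 := ℂ) (S x)
    rw [h3] at hx
    exact norm_eq_zero.mp (pow_eq_zero_iff two_ne_zero |>.mp hx)
  rw [h1, h2, map_zero]

/-- The key inequality `[A y, y] ≥ μ [y, y]`. -/
lemma key_ineq (J A : K →L[ℂ] K) (hJ : IsFundamentalSymmetry J)
    (hA : IsKreinNonneg J A) (hker : ∀ x : K, A x = 0 → x ≠ 0 → kreinRe J x x < 0)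
    (m : ℝ) (hm : 0 ≤ m) (hspec : ∀ t ∈ sigmaR A, 0 < t → m ≤ t) (y : K) :
    m * kreinRe J y y ≤ kreinRe J (A y) y := by
  obtain ⟨S, hS, hSS, hSsa⟩ := pos_sqrt (J ∘L A) hA.1 hA.2
  have hJs : ∀ x y : K, @inner ℂ K _ (J x) y = @inner ℂ K _ x (J y) :=
    fun x y => hJ.1.isSymmetric x y
  have hJJ : ∀ x, J (J x) = x := fun x => congrArg (fun T : K →L[ℂ] K => T x) hJ.2
  have hP : ∀ x, S (S x) = J (A x) := fun x => congrArg (fun T : K →L[ℂ] K => T x) hSS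
  have hAe : A = (J * S) * S := by
    ext x
    simp [hP, hJJ]
  set B : K →L[ℂ] K := S * (J * S) with hB
  have hBsa : IsSelfAdjoint B := by
    rw [IsSelfAdjoint, hB, star_mul, star_mul, hSsa.star_eq, hJ.1.star_eq, mul_assoc]
  have hBspec : ∀ t ∈ spectrum ℝ B, 0 < t → m ≤ t := by
    intro t ht h0
    refine hspec t ?_ h0
    have h1 : (t : ℂ) ∈ spectrum ℂ B := (spectrum.algebraMap_mem_iff ℂ).mpr ht
    have h2 : (t : ℂ) ∈ spectrum ℂ (S * (J * S)) \ {0} :=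
      ⟨h1, by simpa using h0.ne'⟩
    rw [spectrum.nonzero_mul_comm, ← hAe] at h2
    exact h2.1
  have hBB : 0 ≤ B * B - m • B := by
    have h1 : 0 ≤ cfc (fun t : ℝ => t * t - m * t) B := by
      apply cfc_nonneg
      intro t ht
      rcases le_or_gt t 0 with h | h
      · nlinarith [mul_nonneg hm (neg_nonneg.mpr h)]
      · nlinarith [hBspec t ht h]
    rwa [cfc_sub (fun t : ℝ => t * t) (fun t : ℝ => m * t) B,
      cfc_mul (fun t : ℝ => t) (fun t : ℝ => t) B, cfc_const_mul m (fun t : ℝ => t) B,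
      cfc_id' ℝ B] at h1
  have hran : ∀ z, m * kreinRe J (J (S z)) (J (S z)) ≤ kreinRe J (A (J (S z))) (J (S z)) := by
    intro z
    rw [ContinuousLinearMap.nonneg_iff_isPositive, ContinuousLinearMap.isPositive_def'] at hBB
    have h1 := hBB.2 z
    have e0 : (B * B - m • B) z = B (B z) - (m : ℂ) • B z := by
      simp
    have e1 : @inner ℂ K _ (B (B z)) z = @inner ℂ K _ (J (A (J (S z)))) (J (S z)) := by
      simp only [hB, mul_apply_eq_comp]
      rw [hS, hJs, hP]
    have e2 : @inner ℂ K _ (B z) z = @inner ℂ K _ (J (J (S z))) (J (S z)) := by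
      simp only [hB, mul_apply_eq_comp]
      rw [hS, hJJ, hJs]
    rw [ContinuousLinearMap.reApplyInnerSelf_apply, e0, inner_sub_left, inner_smul_left, e1, e2] at h1
    simp at h1
    exact h1
  let N : Submodule ℂ K := LinearMap.ker (A : K →ₗ[ℂ] K)
  let R : Submodule ℂ K := LinearMap.range ((J * S : K →L[ℂ] K) : K →ₗ[ℂ] K)
  have hdense : Dense ((N ⊔ R : Submodule ℂ K) : Set K) := by
    rw [Submodule.dense_iff_topologicalClosure_eq_top, Submodule.topologicalClosure_eq_top_iff,
      Submodule.eq_bot_iff]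
    intro z hz
    rw [Submodule.mem_orthogonal] at hz
    have h1 : S (J z) = 0 := by
      have := hz (J (S (S (J z)))) (Submodule.mem_sup_right ⟨S (J z), rfl⟩)
      rw [hJs, hS] at this
      exact inner_self_eq_zero.mp this
    have h2 : A (J z) = 0 := by
      rw [hAe]; simp [h1]
    have h3 := hz (J z) (Submodule.mem_sup_left h2)
    by_contra hne
    have h4 := hker (J z) h2 (fun h => hne (by rw [← hJJ z, h, map_zero]))
    have : kreinRe J (J z) (J z) = (@inner ℂ K _ (J z) z).re := by
      unfold kreinRe
      rw [hJJ, hJs]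
    rw [this, h3] at h4
    simp at h4
  have hcl : IsClosed {y : K | m * kreinRe J y y ≤ kreinRe J (A y) y} := by
    unfold kreinRe
    apply isClosed_le
    · exact continuous_const.mul (Complex.continuous_re.comp (J.continuous.inner continuous_id))
    · exact Complex.continuous_re.comp ((J.continuous.comp A.continuous).inner continuous_id)
  have hsub : ((N ⊔ R : Submodule ℂ K) : Set K) ⊆
      {y : K | m * kreinRe J y y ≤ kreinRe J (A y) y} := by
    intro y hy
    obtain ⟨n, hn, r, ⟨z, hz⟩, rfl⟩ := Submodule.mem_sup.mp hy
    have hn : A n = 0 := hn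
    have hz : J (S z) = r := hz
    have hr := hran z
    rw [hz] at hr
    have hSn : S n = 0 := by
      have : @inner ℂ K _ (S n) (S n) = 0 := by
        rw [← hS, hP, hn, map_zero, inner_zero_left]
      exact inner_self_eq_zero.mp this
    have c1 : @inner ℂ K _ (J r) n = 0 := by
      rw [← hz, hJJ, hS, hSn, inner_zero_right]
    have c2 : @inner ℂ K _ (J n) r = 0 := by
      rw [hJs, ← inner_conj_symm, c1, map_zero]
    have c3 : @inner ℂ K _ (J (A r)) n = 0 := by
      rw [← hP, hS, hSn, inner_zero_right]
    have hnn : kreinRe J n n ≤ 0 := by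
      by_cases h : n = 0
      · subst h; simp [kreinRe]
      · exact (hker n hn h).le
    have f1 : kreinRe J (n + r) (n + r) = kreinRe J n n + kreinRe J r r := by
      unfold kreinRe
      rw [map_add, inner_add_left, inner_add_right, inner_add_right, c1, c2]
      simp
    have f2 : kreinRe J (A (n + r)) (n + r) = kreinRe J (A r) r := by
      unfold kreinRe
      rw [map_add, hn, zero_add, inner_add_right, c3, zero_add]
    show m * kreinRe J (n + r) (n + r) ≤ kreinRe J (A (n + r)) (n + r)
    rw [f1, f2]
    nlinarith
  exact hcl.closure_subset_iff.mpr hsub (hdense y)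

lemma half (J A : K →L[ℂ] K) (hJ : IsFundamentalSymmetry J)
    (hA : IsKreinNonneg J A) (hker : ∀ x : K, A x = 0 → x ≠ 0 → kreinRe J x x < 0)
    (m : ℝ) (hm : 0 ≤ m) (hspec : ∀ t ∈ sigmaR A, 0 < t → m ≤ t) :
    m ∈ kreinW J A ↔ ∃ x : K, x ≠ 0 ∧ A x = (m : ℂ) • x := by
  have hJJ : ∀ x, J (J x) = x := fun x => congrArg (fun T : K →L[ℂ] K => T x) hJ.2
  constructor
  · rintro ⟨x, hx, hr⟩
    rw [eq_div_iff hx] at hr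
    refine ⟨x, fun h => hx (by simp [h, kreinRe]), ?_⟩
    have hsa : IsSelfAdjoint (J ∘L A - m • J) := by
      refine hA.1.sub ?_
      rw [IsSelfAdjoint, star_smul, hJ.1.star_eq, star_trivial]
    have hform : ∀ y, (@inner ℂ K _ ((J ∘L A - m • J) y) y).re
        = kreinRe J (A y) y - m * kreinRe J y y := by
      intro y
      have e0 : (J ∘L A - m • J) y = J (A y) - (m : ℂ) • J y := by simp
      rw [e0, inner_sub_left, inner_smul_left]
      simp [kreinRe]
    have h0 := pos_zero _ hsa (fun y => by
      rw [hform]; linarith [key_ineq J A hJ hA hker m hm hspec y]) x (by rw [hform]; linarith)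
    have h1 : J (A x) = J ((m : ℂ) • x) := by
      have e0 : (J ∘L A - m • J) x = J (A x) - (m : ℂ) • J x := by simp
      rw [e0, sub_eq_zero] at h0
      rw [h0, map_smul]
    rw [← hJJ (A x), h1, hJJ]
  · rintro ⟨x, hx, hAx⟩
    have e : kreinRe J (A x) x = m * kreinRe J x x := by
      unfold kreinRe
      rw [hAx, map_smul, inner_smul_left]
      simp
    have hne : kreinRe J x x ≠ 0 := by
      intro h
      rw [h, mul_zero] at e
      have h1 : J (A x) = 0 := pos_zero (J ∘L A) hA.1 hA.2 x e
      have h2 : A x = 0 := by rw [← hJJ (A x), h1, map_zero]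
      exact (hker x h2 hx).ne h
    exact ⟨x, hne, by rw [e, mul_div_cancel_right₀ _ hne]⟩

/-- Membership of `μ₋` (resp. `μ₊`) in `W(A)` is equivalent to being an eigenvalue,
in the cases where `ker A = {0}` or `ker A ≠ {0}` is positive (resp. negative). -/
theorem stmt_7 (J A : K →L[ℂ] K) (hJ : IsFundamentalSymmetry J)
    (hA : IsKreinNonneg J A) (hA0 : A ≠ 0) (hind : KreinIndefinite J) :
    (((∀ x : K, A x = 0 → x = 0) ∨
        ((∃ x : K, x ≠ 0 ∧ A x = 0) ∧
          ∀ x : K, A x = 0 → x ≠ 0 → 0 < kreinRe J x x)) →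
      (sigmaR A ∩ Set.Iio 0).Nonempty →
      (sSup (sigmaR A ∩ Set.Iio 0) ∈ kreinW J A ↔
        ∃ x : K, x ≠ 0 ∧ A x = ((sSup (sigmaR A ∩ Set.Iio 0) : ℝ) : ℂ) • x)) ∧
    (((∀ x : K, A x = 0 → x = 0) ∨
        ((∃ x : K, x ≠ 0 ∧ A x = 0) ∧
          ∀ x : K, A x = 0 → x ≠ 0 → kreinRe J x x < 0)) →
      (sigmaR A ∩ Set.Ioi 0).Nonempty →
      (sInf (sigmaR A ∩ Set.Ioi 0) ∈ kreinW J A ↔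
        ∃ x : K, x ≠ 0 ∧ A x = ((sInf (sigmaR A ∩ Set.Ioi 0) : ℝ) : ℂ) • x)) := by
  have neg1 : ∀ x y, kreinRe (-J) x y = - kreinRe J x y := by
    intro x y; simp [kreinRe]
  have neg2 : ∀ x y, kreinRe (-J) ((-A) x) y = kreinRe J (A x) y := by
    intro x y; simp [kreinRe]
  refine ⟨fun hk hne => ?_, fun hk hne => ?_⟩
  · have hle : sSup (sigmaR A ∩ Set.Iio 0) ≤ 0 := csSup_le hne fun t ht => ht.2.le
    set s := sSup (sigmaR A ∩ Set.Iio 0) with hs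
    have hcomp : (-J) ∘L (-A) = J ∘L A := by ext x; simp
    have h := half (-J) (-A) ⟨hJ.1.neg, by rw [← hJ.2]; ext x; simp⟩
      ⟨by rw [hcomp]; exact hA.1, fun x => by rw [neg2]; exact hA.2 x⟩
      (by
        intro x hx hx0
        have hx' : A x = 0 := by simpa using hx
        rw [neg1]
        rcases hk with hk | hk
        · exact absurd (hk x hx') hx0
        · linarith [hk.2 x hx' hx0])
      (-s) (by linarith)
      (by
        intro t ht h0
        have h1 : (-t) ∈ sigmaR A := by
          have h2 : (t : ℂ) ∈ spectrum ℂ (-A) := ht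
          rw [← spectrum.neg_eq, Set.mem_neg] at h2
          show ((-t : ℝ) : ℂ) ∈ spectrum ℂ A
          simpa using h2
        have := le_csSup (s := sigmaR A ∩ Set.Iio 0) ⟨0, fun t ht => ht.2.le⟩
          ⟨h1, by simpa using h0⟩
        linarith)
    have hW : -s ∈ kreinW (-J) (-A) ↔ s ∈ kreinW J A := by
      simp only [kreinW, Set.mem_ofPred_eq, neg1 _ _, neg2]
      simp [kreinRe, div_neg]
    rw [← hW, h]
    simp
  · refine half J A hJ hA ?_ _ (le_csInf hne fun t ht => ht.2.le) ?_
    · intro x hx hx0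
      rcases hk with hk | hk
      · exact absurd (hk x hx) hx0
      · exact hk.2 x hx hx0
    · intro t ht h0
      exact csInf_le ⟨0, fun t ht => ht.2.le⟩ ⟨ht, h0⟩
end
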